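/- Let C be the hyperbolic parabola λ(x₁² + x₂² − x₀²) + (x₀+x₁)(μ(x₀+x₁) + x₁) = 0 with λ ∉ {0, −1/2} and μ ∈ ℝ. Then the Frégier locus of C with respect to the absolute conic x₁² + x₂² = x₀² is contained in a line if and only if λ = −1. -/

import Mathlib

/-- Points of the real projective plane, given by homogeneous coordinates `[x₀, x₁, x₂]`. -/
abbrev PP := Fin 3 → ℝ

/-- Cross product: line joining two points / point of intersection of two lines. -/
def cross3 (a b : PP) : PP :=
  ![a 1 * b 2 - a 2 * b 1, a 2 * b 0 - a 0 * b 2, a 0 * b 1 - a 1 * b 0]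

def dot3 (a b : PP) : ℝ := a 0 * b 0 + a 1 * b 1 + a 2 * b 2

/-- `q`, `r`, `f` are collinear. -/
def Coll (q r f : PP) : Prop := dot3 (cross3 q r) f = 0

/-- Euclidean perpendicularity of the lines `pq` and `pr`
(standard inner product on directions in the affine chart `x₀ = 1`). -/
def EuclidPerp (p q r : PP) : Prop :=
  (q 1 * p 0 - p 1 * q 0) * (r 1 * p 0 - p 1 * r 0) +
    (q 2 * p 0 - p 2 * q 0) * (r 2 * p 0 - p 2 * r 0) = 0

/-- Hyperbolic perpendicularity of the lines `pq` and `pr`: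
conjugacy with respect to the absolute conic `N : x₁² + x₂² = x₀²`
(a line is perpendicular to another iff it contains its pole w.r.t. `N`). -/
def HypPerp (p q r : PP) : Prop :=
  -(cross3 p q 0 * cross3 p r 0) + cross3 p q 1 * cross3 p r 1 +
    cross3 p q 2 * cross3 p r 2 = 0

/-- Elliptic perpendicularity of the lines `pq` and `pr`:
conjugacy with respect to the absolute polarity `x₀² + x₁² + x₂²`. -/
def EllPerp (p q r : PP) : Prop :=
  dot3 (cross3 p q) (cross3 p r) = 0

/-- `f` lies on every chord `qr` of the conic `C` such that the legs `pq`, `pr`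
are perpendicular (a right triangle inscribed in `C` with right angle at `p`). -/
def IsFregier (OnC : PP → Prop) (Perp : PP → PP → PP → Prop) (p f : PP) : Prop :=
  ∀ q r : PP, OnC q → OnC r → cross3 p q ≠ 0 → cross3 p r ≠ 0 → Perp p q r →
    Coll q r f

/-- `f` is THE Frégier point of the conic `C` at `p`: the common point of the
hypotenuses of all right triangles inscribed in `C` with right angle at `p`
(unique up to scalar). -/
def IsFregierPoint (OnC : PP → Prop) (Perp : PP → PP → PP → Prop) (p f : PP) : Prop :=
  f ≠ 0 ∧ IsFregier OnC Perp p f ∧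
    ∀ f' : PP, f' ≠ 0 → IsFregier OnC Perp p f' → ∃ t : ℝ, t ≠ 0 ∧ f' = t • f

/-- The Frégier locus of a conic: all Frégier points as `p` varies on the conic. -/
def FregierLocus (OnC : PP → Prop) (Perp : PP → PP → PP → Prop) : Set PP :=
  { f | ∃ p : PP, p ≠ 0 ∧ OnC p ∧ IsFregierPoint OnC Perp p f }

/-- Parametrization of the hyperbolic parabola. -/
noncomputable def hpt (l μ s t : ℝ) : PP :=
  ![(l + 1/2) * s^2 + (l * t^2 + (μ + 1/2) * s^2),
    (l + 1/2) * s^2 - (l * t^2 + (μ + 1/2) * s^2), 2 * ((l + 1/2) * s * t)]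

/-- The Frégier point at parameter `(s : t)`. -/
noncomputable def hF (l μ s t : ℝ) : PP :=
  ![-l * (l + 1/2) * s^2 - ((4 * (l + 1/2) + l) * (μ + 1/2) * s^2 + l^2 * t^2),
    -l * (l + 1/2) * s^2 + ((4 * (l + 1/2) + l) * (μ + 1/2) * s^2 + l^2 * t^2),
    2 * (-(l + 1) * (l + 1/2) * t * s)]

/-- The involution form. -/
noncomputable def hE (l μ s t x y z w : ℝ) : ℝ :=
  l^2 * s^2 * y * w - l * (l + 1) * t * s * (y * z + w * x)
    + (4 * (l + 1/2) * (μ + 1/2) * s^2 + l^2 * t^2) * x * z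

/-- The conic. -/
def hC (l μ : ℝ) (v : PP) : Prop :=
  l * (v 1 ^ 2 + v 2 ^ 2 - v 0 ^ 2) + (v 0 + v 1) * (μ * (v 0 + v 1) + v 1) = 0

theorem hC_pt (l μ s t : ℝ) : hC l μ (hpt l μ s t) := by
  simp only [hC, hpt, Matrix.cons_val]
  ring

theorem hC_param (l μ : ℝ) (hl0 : l ≠ 0) (hl : l + 1/2 ≠ 0) (q : PP) (h : hC l μ q) :
    ∃ c s t : ℝ, q = c • hpt l μ s t := by
  unfold hC at h
  by_cases hu : q 0 + q 1 = 0
  · have h1 : q 1 = - q 0 := by linarith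
    have h2 : q 2 = 0 := by
      rw [h1] at h
      have : l * (q 2)^2 = 0 := by linear_combination h
      simpa [hl0] using this
    refine ⟨q 0 / l, 0, 1, ?_⟩
    ext i
    fin_cases i
    · simp [hpt]; field_simp
    · simp [hpt, h1]; field_simp
    · simp [hpt, h2]
  · refine ⟨(q 0 + q 1) / (2 * (l + 1/2)), 1, q 2 / (q 0 + q 1), ?_⟩
    have hl2 : 2 * l + 1 ≠ 0 := fun h => hl (by linarith)
    ext i
    fin_cases i
    · simp only [hpt, Pi.smul_apply, smul_eq_mul, Fin.zero_eta, Matrix.cons_val_zero]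
      field_simp
      linear_combination (-2) * h
    · simp only [hpt, Pi.smul_apply, smul_eq_mul, Fin.mk_one, Matrix.cons_val_one, Matrix.cons_val_zero]
      field_simp
      linear_combination 2 * h
    · simp only [hpt, Pi.smul_apply, smul_eq_mul, Fin.reduceFinMk, Matrix.cons_val]
      field_simp

theorem h_perp (l μ c d e s t x y z w : ℝ) :
    HypPerp (c • hpt l μ s t) (d • hpt l μ x y) (e • hpt l μ z w) ↔
      c^2 * d * e * (4 * (l + 1/2)^2 * (s*y - t*x) * (s*w - t*z)) * hE l μ s t x y z w = 0 := by
  simp only [HypPerp, cross3, hpt, hE, Pi.smul_apply, smul_eq_mul, Matrix.cons_val]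
  constructor <;> intro h <;> linear_combination h

theorem h_coll (l μ d e x y z w : ℝ) (f : PP) :
    Coll (d • hpt l μ x y) (e • hpt l μ z w) f ↔
      d * e * (l + 1/2) * (x*w - y*z) *
       ((f 0 + f 1) * ((μ + 1/2) * x * z - l * y * w) + f 2 * l * (y*z + w*x)
         + (f 1 - f 0) * (l + 1/2) * x * z) = 0 := by
  simp only [Coll, dot3, cross3, hpt, Pi.smul_apply, smul_eq_mul, Matrix.cons_val]
  constructor <;> intro h
  · linear_combination (-1/2) * h
  · linear_combination (-2) * h

theorem h_cross (l μ c d s t x y : ℝ)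
    (h : cross3 (c • hpt l μ s t) (d • hpt l μ x y) ≠ 0) : c ≠ 0 ∧ d ≠ 0 ∧ s*y - t*x ≠ 0 := by
  refine ⟨?_, ?_, ?_⟩
  · rintro rfl
    apply h; ext i; fin_cases i <;> simp [cross3]
  · rintro rfl
    apply h; ext i; fin_cases i <;> simp [cross3]
  · intro h0
    apply h; ext i; fin_cases i <;> simp [cross3, hpt]
    · linear_combination c * d * 4 * (l+1/2) * h0 * (((μ+1/2) * s * x - l * t * y) - (l+1/2)*s*x) * (-1/2)
    · linear_combination c * d * 4 * (l+1/2) * h0 * (((μ+1/2) * s * x - l * t * y) + (l+1/2)*s*x) * (-1/2)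
    · linear_combination c * d * 4 * (l+1/2) * h0 * (l * (t*x+s*y)) * (-1/2)

theorem h_cross' (l μ s t x y : ℝ) (hl0 : l ≠ 0) (hl : l + 1/2 ≠ 0) (hs : s ≠ 0)
    (h : s*y - t*x ≠ 0) : cross3 (hpt l μ s t) (hpt l μ x y) ≠ 0 := by
  intro h0
  have e0 := congrFun h0 0
  have e1 := congrFun h0 1
  have e2 := congrFun h0 2
  simp only [cross3, hpt, Matrix.cons_val, Pi.zero_apply] at e0 e1 e2
  have hx : (l+1/2)^2 * (s*y-t*x) * s * x = 0 := by linear_combination (e0 - e1)/4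
  have hx0 : x = 0 := (mul_eq_zero.1 hx).resolve_left
    (mul_ne_zero (mul_ne_zero (pow_ne_zero 2 hl) h) hs)
  subst hx0
  have : (l+1/2) * l * (s*y)^2 = 0 := by linear_combination (-1/2) * e2
  have h' : s * y ≠ 0 := by simpa using h
  exact mul_ne_zero (mul_ne_zero hl hl0) (pow_ne_zero 2 h') this

theorem hF_isFregier (l μ c s t : ℝ) (hl0 : l ≠ 0) (hl : l + 1/2 ≠ 0) :
    IsFregier (hC l μ) HypPerp (c • hpt l μ s t) (hF l μ s t) := by
  intro q r hq hr hpq hpr hp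
  obtain ⟨d, x, y, rfl⟩ := hC_param l μ hl0 hl q hq
  obtain ⟨e, z, w, rfl⟩ := hC_param l μ hl0 hl r hr
  obtain ⟨hc, hd, h1⟩ := h_cross _ _ _ _ _ _ _ _ hpq
  obtain ⟨_, he, h2⟩ := h_cross _ _ _ _ _ _ _ _ hpr
  rw [h_perp] at hp
  have hE0 : hE l μ s t x y z w = 0 := by
    rcases mul_eq_zero.1 hp with h | h
    · exfalso
      revert h
      positivity
    · exact h
  rw [h_coll]
  simp only [hE] at hE0
  simp only [hF, Matrix.cons_val]
  linear_combination d * e * (l + 1/2)^2 * (x*w - y*z) * 2 * hE0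

theorem hF_point (l μ t : ℝ) (hl0 : l ≠ 0) (hl : l + 1/2 ≠ 0) (hl1 : l + 1 ≠ 0) (ht : t ≠ 0)
    (hg : 4 * (l + 1/2) * (μ + 1/2) - l * t^2 ≠ 0)
    (hc : 4 * (l + 1/2) * (μ + 1/2) + l^2 * t^2 ≠ 0) :
    hF l μ 1 t ∈ FregierLocus (hC l μ) HypPerp := by
  have hFu : hF l μ 1 t 0 + hF l μ 1 t 1 = -2 * l * (l + 1/2) := by
    simp only [hF, Matrix.cons_val]; ring
  have hp0 : hpt l μ 1 t ≠ 0 := by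
    intro h
    have e0 := congrFun h 0
    have e1 := congrFun h 1
    simp only [hpt, Matrix.cons_val, Pi.zero_apply] at e0 e1
    apply hl
    linear_combination (e0 + e1)/2
  refine ⟨hpt l μ 1 t, hp0, hC_pt _ _ _ _, ?_, ?_, ?_⟩
  · intro h
    rw [h] at hFu
    have : l * (l + 1/2) = 0 := by simp at hFu ⊢; tauto
    simp [hl0] at this
    exact hl (by linarith)
  · simpa using hF_isFregier l μ 1 1 t hl0 hl
  · intro f hf0 hf
    have a1 := hf (hpt l μ 0 1) (hpt l μ l ((l+1)*t)) (hC_pt _ _ _ _) (hC_pt _ _ _ _)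
      (h_cross' _ _ _ _ _ _ hl0 hl one_ne_zero (by simp))
      (h_cross' _ _ _ _ _ _ hl0 hl one_ne_zero (by ring_nf; exact ht))
      (by
        have := (h_perp l μ 1 1 1 1 t 0 1 l ((l+1)*t)).2 (by simp only [hE]; ring)
        simpa using this)
    have a2 := hf (hpt l μ 1 0) (hpt l μ (l*(l+1)*t) (4 * (l+1/2)*(μ+1/2) + l^2*t^2))
      (hC_pt _ _ _ _) (hC_pt _ _ _ _)
      (h_cross' _ _ _ _ _ _ hl0 hl one_ne_zero (by simpa using ht))
      (h_cross' _ _ _ _ _ _ hl0 hl one_ne_zero (by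
        intro h; apply hg; linear_combination h))
      (by
        have := (h_perp l μ 1 1 1 1 t 1 0 (l*(l+1)*t) (4 * (l+1/2)*(μ+1/2) + l^2*t^2)).2
          (by simp only [hE]; ring)
        simpa using this)
    have b1 := (h_coll l μ 1 1 0 1 l ((l+1)*t) f).1 (by simpa using a1)
    have b2 := (h_coll l μ 1 1 1 0 (l*(l+1)*t) (4 * (l+1/2)*(μ+1/2) + l^2*t^2) f).1
      (by simpa using a2)
    have c1 : f 2 * l = (f 0 + f 1) * (l+1) * t := by
      have : ((l+1/2) * l^2) * (f 2 * l - (f 0 + f 1) * (l+1) * t) = 0 := by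
        linear_combination -b1
      rcases mul_eq_zero.1 this with h | h
      · exact absurd h (mul_ne_zero hl (pow_ne_zero 2 hl0))
      · linarith
    have c2 : (f 1 - f 0) * (l+1/2) * l =
        -(f 0 + f 1) * ((μ+1/2) * l + (4 * (l+1/2)*(μ+1/2) + l^2*t^2)) := by
      have : ((l+1/2) * (4 * (l+1/2)*(μ+1/2) + l^2*t^2) * ((l+1) * t)) *
          ((f 1 - f 0) * (l+1/2) * l +
            (f 0 + f 1) * ((μ+1/2) * l + (4 * (l+1/2)*(μ+1/2) + l^2*t^2))) = 0 := by
        linear_combination b2 - (l+1/2) * (4 * (l+1/2)*(μ+1/2) + l^2*t^2)^2 * c1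
      rcases mul_eq_zero.1 this with h | h
      · exact absurd h (mul_ne_zero (mul_ne_zero hl hc) (mul_ne_zero hl1 ht))
      · linarith
    have hl2 : 2 * l + 1 ≠ 0 := fun h => hl (by linarith)
    have hfe : f = (-(f 0 + f 1) / (2 * l * (l+1/2))) • hF l μ 1 t := by
      ext i
      fin_cases i
      · simp only [hF, Pi.smul_apply, smul_eq_mul, Fin.zero_eta, Matrix.cons_val]
        rw [div_mul_eq_mul_div, eq_div_iff (mul_ne_zero (mul_ne_zero two_ne_zero hl0) hl)]
        linear_combination -c2
      · simp only [hF, Pi.smul_apply, smul_eq_mul, Fin.mk_one, Matrix.cons_val]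
        rw [div_mul_eq_mul_div, eq_div_iff (mul_ne_zero (mul_ne_zero two_ne_zero hl0) hl)]
        linear_combination c2
      · simp only [hF, Pi.smul_apply, smul_eq_mul, Fin.reduceFinMk, Matrix.cons_val]
        rw [div_mul_eq_mul_div, eq_div_iff (mul_ne_zero (mul_ne_zero two_ne_zero hl0) hl)]
        linear_combination 2 * (l+1/2) * c1
    refine ⟨_, ?_, hfe⟩
    intro h
    rw [h, zero_smul] at hfe
    exact hf0 hfe

/-- For the hyperbolic parabola
`C : λ(x₁² + x₂² − x₀²) + (x₀+x₁)(μ(x₀+x₁) + x₁) = 0` with `λ ∉ {0, −1/2}`,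
the Frégier locus is contained in a line iff `λ = −1`. -/
theorem fregier_locus_of_hyperbolic_parabola_singular_iff
    (l μ : ℝ) (hl0 : l ≠ 0) (hl : l ≠ -(1 / 2)) :
    (∃ L : PP, L ≠ 0 ∧
        ∀ f ∈ FregierLocus
          (fun v => l * (v 1 ^ 2 + v 2 ^ 2 - v 0 ^ 2)
            + (v 0 + v 1) * (μ * (v 0 + v 1) + v 1) = 0) HypPerp,
          dot3 L f = 0)
      ↔ l = -1 := by
  have hl' : l + 1/2 ≠ 0 := fun h => hl (by linarith)
  change (∃ L : PP, L ≠ 0 ∧ ∀ f ∈ FregierLocus (hC l μ) HypPerp, dot3 L f = 0) ↔ l = -1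
  constructor
  · rintro ⟨L, hL0, hL⟩
    by_contra hne
    have hl1 : l + 1 ≠ 0 := fun h => hne (by linarith)
    set K := 4 * (l + 1/2) * (μ + 1/2) / l with hK
    obtain ⟨T, hT1, hT2, hT3⟩ : ∃ T : ℝ, 1 ≤ T ∧ K < T^2 ∧ -K/l < T^2 :=
      ⟨|K| + |-K/l| + 1, by linarith [abs_nonneg K, abs_nonneg (-K/l)],
        by nlinarith [abs_nonneg K, le_abs_self K, abs_nonneg (-K/l)],
        by nlinarith [abs_nonneg K, le_abs_self (-K/l), abs_nonneg (-K/l)]⟩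
    have key : ∀ t : ℝ, T^2 ≤ t^2 → dot3 L (hF l μ 1 t) = 0 := by
      intro t ht
      apply hL
      apply hF_point _ _ _ hl0 hl' hl1
      · rintro rfl
        nlinarith
      · intro h
        have : K = t^2 := by rw [hK]; field_simp; linear_combination 4 * h
        linarith
      · intro h
        have : -K/l = t^2 := by rw [hK]; field_simp; linear_combination -4 * h
        linarith
    have k1 := key T le_rfl
    have k2 := key (-T) (by simp)
    have k3 := key (2*T) (by nlinarith)
    simp only [dot3, hF, Matrix.cons_val] at k1 k2 k3
    have hT0 : T ≠ 0 := by positivity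
    have m2 : (l+1) * (l+1/2) * T * L 2 = 0 := by linear_combination (k2 - k1)/4
    have n2 : L 2 = 0 := by
      rcases mul_eq_zero.1 m2 with h | h
      · exact absurd h (by simp [hl1, hT0]; simpa using hl')
      · exact h
    rw [n2] at k1 k2 k3
    have m1 : l^2 * T^2 * (L 1 - L 0) = 0 := by linear_combination (k3 - k1)/3
    have n1 : L 1 = L 0 := by
      rcases mul_eq_zero.1 m1 with h | h
      · exact absurd h (by simp [hl0, hT0])
      · linarith
    rw [n1] at k1
    have m0 : l * (l+1/2) * L 0 = 0 := by linear_combination (-1/2) * k1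
    have n0 : L 0 = 0 := by
      rcases mul_eq_zero.1 m0 with h | h
      · exact absurd h (by simp [hl0]; simpa using hl')
      · exact h
    apply hL0
    ext i
    fin_cases i
    · exact n0
    · exact n1.trans n0
    · exact n2
  · rintro rfl
    refine ⟨![0, 0, 1], fun h => by simpa using congrFun h 2, ?_⟩
    rintro f ⟨p, hp0, hp, hf0, hf, huniq⟩
    obtain ⟨c, s, t, rfl⟩ := hC_param _ μ hl0 hl' p hp
    have hF0 : hF (-1) μ s t ≠ 0 := by
      intro h
      have e0 := congrFun h 0
      have e1 := congrFun h 1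
      simp only [hF, Matrix.cons_val, Pi.zero_apply] at e0 e1
      have hs2 : s^2 = 0 := by linear_combination (-1) * (e0 + e1)
      have hs : s = 0 := by simpa using hs2
      subst hs
      have ht2 : t^2 = 0 := by linear_combination e1
      have ht : t = 0 := by simpa using ht2
      subst ht
      apply hp0
      ext i; fin_cases i <;> simp [hpt]
    obtain ⟨r, hr, hrf⟩ := huniq _ hF0 (hF_isFregier (-1) μ c s t hl0 hl')
    have e2 := congrFun hrf 2
    simp [hF, hr] at e2
    simp [dot3, e2]
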